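/- Assume α(0) > 0. Then every classical solution (w, u, v) of system (S) with positive data remains bounded away from zero: there exists ε > 0 such that w(t) ≥ ε, v(t) ≥ ε, and u(x,t) ≥ ε for all t ≥ 0 and x ∈ [0,x*]. -/

import Mathlib

lemma barrier_aux (f f' : ℝ → ℝ) (m : ℝ) (hc : ContinuousOn f (Set.Ici 0))
    (hd : ∀ t > 0, HasDerivAt f (f' t) t) (h0 : m ≤ f 0)
    (hb : ∀ t > 0, f t < m → 0 ≤ f' t) : ∀ t ≥ 0, m ≤ f t := by
  intro t1 ht1
  by_contra hlt
  push Not at hlt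
  have hcI : ContinuousOn f (Set.Icc 0 t1) := hc.mono Set.Icc_subset_Ici_self
  have hcl : IsCompact (Set.Icc 0 t1 ∩ f ⁻¹' Set.Ici m) :=
    isCompact_Icc.of_isClosed_subset
      (hcI.preimage_isClosed_of_isClosed isClosed_Icc isClosed_Ici) Set.inter_subset_left
  obtain ⟨s, ⟨⟨hs0, hs1⟩, hsm⟩, hsmax⟩ := hcl.exists_isGreatest ⟨0, ⟨le_refl _, ht1⟩, h0⟩
  have hmono : MonotoneOn f (Set.Icc s t1) := by
    apply monotoneOn_of_deriv_nonneg (convex_Icc s t1)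
    · exact hcI.mono (Set.Icc_subset_Icc_left hs0)
    · intro x hx
      rw [interior_Icc] at hx
      exact (hd x (lt_of_le_of_lt hs0 hx.1)).differentiableAt.differentiableWithinAt
    · intro x hx
      rw [interior_Icc] at hx
      have hx0 : 0 < x := lt_of_le_of_lt hs0 hx.1
      rw [(hd x hx0).deriv]
      apply hb x hx0
      by_contra hge
      push Not at hge
      exact absurd (hsmax ⟨⟨hx0.le, hx.2.le⟩, hge⟩) (not_le.mpr hx.1)
  have := hmono (Set.left_mem_Icc.mpr hs1) (Set.right_mem_Icc.mpr hs1) hs1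
  have h3 : m ≤ f s := hsm
  linarith

lemma deriv_nonneg_of_left_max (f : ℝ → ℝ) (a b d : ℝ) (hab : a < b)
    (hd : HasDerivAt f d b) (hm : ∀ y ∈ Set.Icc a b, f y ≤ f b) : 0 ≤ d := by
  have h1 := (hasDerivAt_iff_tendsto_slope_left_right.mp hd).1
  refine ge_of_tendsto h1 ?_
  filter_upwards [Ioo_mem_nhdsLT hab] with y hy
  rw [slope_def_field]
  apply div_nonneg_of_nonpos
  · linarith [hm y ⟨hy.1.le, hy.2.le⟩]
  · linarith [hy.2]

lemma max_principle_aux (f : ℝ → ℝ → ℝ) (X M : ℝ) (hX : 0 < X)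
    (hc : ContinuousOn (fun q : ℝ × ℝ => f q.1 q.2) (Set.Icc 0 X ×ˢ Set.Ici 0))
    (h0 : ∀ x ∈ Set.Icc 0 X, f x 0 ≤ M) (hb : ∀ t ≥ 0, f 0 t ≤ M)
    (hd : ∀ t > 0, ∀ x ∈ Set.Ioo 0 X, ∃ a b G : ℝ, 0 < G ∧ HasDerivAt (fun s => f x s) a t ∧
      HasDerivAt (fun y => f y t) b x ∧ a + G * b < 0) :
    ∀ t ≥ 0, ∀ x ∈ Set.Icc 0 X, f x t ≤ M := by
  have key : ∀ t ≥ 0, ∀ x ∈ Set.Ico 0 X, f x t ≤ M := by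
    intro T hT x1 hx1
    have hK : IsCompact (Set.Icc (0:ℝ) x1 ×ˢ Set.Icc (0:ℝ) T) := isCompact_Icc.prod isCompact_Icc
    obtain ⟨⟨x, t⟩, ⟨⟨hx0, hx⟩, ⟨ht0, ht⟩⟩, hmax⟩ := hK.exists_isMaxOn
      ⟨(0, 0), ⟨⟨le_refl _, hx1.1⟩, ⟨le_refl _, hT⟩⟩⟩
      (hc.mono (Set.prod_mono (Set.Icc_subset_Icc_right hx1.2.le) Set.Icc_subset_Ici_self))
    simp only at hx0 hx ht0 ht
    have hmax' : ∀ y s, 0 ≤ y → y ≤ x1 → 0 ≤ s → s ≤ T → f y s ≤ f x t := by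
      intro y s h1 h2 h3 h4
      exact hmax (a := (y, s)) ⟨⟨h1, h2⟩, ⟨h3, h4⟩⟩
    refine (hmax' x1 T hx1.1 le_rfl hT le_rfl).trans ?_
    rcases hx0.eq_or_lt with rfl | hx0
    · exact hb t ht0
    rcases ht0.eq_or_lt with rfl | ht0
    · exact h0 x ⟨hx0.le, hx.trans hx1.2.le⟩
    obtain ⟨a, b, G, hG, ha, hbd, hneg⟩ := hd t ht0 x ⟨hx0, lt_of_le_of_lt hx hx1.2⟩
    have h1 := deriv_nonneg_of_left_max _ 0 t a ht0 ha
      (fun s hs => hmax' x s hx0.le hx hs.1 (hs.2.trans ht))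
    have h2 := deriv_nonneg_of_left_max _ 0 x b hx0 hbd
      (fun y hy => hmax' y t hy.1 (hy.2.trans hx) ht0.le ht)
    have := mul_nonneg hG.le h2
    linarith
  intro t ht x hx
  rcases hx.2.eq_or_lt with rfl | hlt
  · have hcx : ContinuousOn (fun y => f y t) (Set.Icc 0 x) :=
      hc.comp (f := fun y : ℝ => (y, t)) (by fun_prop) (fun y hy => ⟨hy, ht⟩)
    have hcw : ContinuousWithinAt (fun y => f y t) (Set.Ico 0 x) x :=
      (hcx x ⟨hx.1, le_rfl⟩).mono Set.Ico_subset_Icc_self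
    refine ContinuousWithinAt.closure_le (s := Set.Ico 0 x) (f := fun y => f y t) (g := fun _ => M) ?_ hcw
      continuousWithinAt_const (fun y hy => key t ht y hy)
    rw [closure_Ico hX.ne]
    exact hx
  · exact key t ht x ⟨hx.1, hlt⟩


theorem persistence
    (xstar mu : ℝ) (hxstar : 0 < xstar) (hmu : 0 < mu)
    (α : ℝ → ℝ) (g : ℝ → ℝ → ℝ) (p : ℝ → ℝ)
    (αinf α0 : ℝ) (hαinf : αinf < 0)
    (hαcont : ContinuousOn α (Set.Ici 0))
    (hαanti : StrictAntiOn α (Set.Ici 0))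
    (hαrange : ∀ s ∈ Set.Ici (0:ℝ), α s ∈ Set.Icc αinf α0)
    (hαlim : Filter.Tendsto α Filter.atTop (nhds αinf))
    (hpC1 : ContDiffOn ℝ 1 p (Set.Icc 0 xstar))
    (hgC2 : ∀ s ∈ Set.Ici (0:ℝ), ContDiffOn ℝ 2 (fun x => g x s) (Set.Icc 0 xstar))
    (Kg : ℝ)
    (hgderivbdd : ∀ x ∈ Set.Icc 0 xstar, ∀ s ∈ Set.Ici (0:ℝ),
      |deriv (fun y => g y s) x| ≤ Kg ∧ |deriv (deriv (fun y => g y s)) x| ≤ Kg)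
    (gm gp : ℝ) (hgm : 0 < gm)
    (hgbound : ∀ x ∈ Set.Icc 0 xstar, ∀ s ∈ Set.Ici (0:ℝ), g x s ∈ Set.Icc gm gp)
    (w v : ℝ → ℝ) (u : ℝ → ℝ → ℝ)
    (hwC1 : ContDiffOn ℝ 1 w (Set.Ici 0))
    (hvC1 : ContDiffOn ℝ 1 v (Set.Ici 0))
    (huC1 : ContDiffOn ℝ 1 (fun q : ℝ × ℝ => u q.1 q.2) (Set.Icc 0 xstar ×ˢ Set.Ici 0))
    (hu0C1 : ContDiffOn ℝ 1 (fun x => u x 0) (Set.Icc 0 xstar))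
    (hweq : ∀ t > (0:ℝ), HasDerivAt w (α (v t) * w t) t)
    (hueq : ∀ t > (0:ℝ), ∀ x ∈ Set.Ioo 0 xstar,
      deriv (fun s => u x s) t + deriv (fun y => g y (v t) * u y t) x = p x * u x t)
    (hbc : ∀ t ≥ (0:ℝ), u 0 t = w t)
    (hveq : ∀ t > (0:ℝ), HasDerivAt v (g xstar (v t) * u xstar t - mu * v t) t)
    (hw0 : 0 < w 0) (hv0 : 0 < v 0)
    (hu0pos : ∀ x ∈ Set.Icc 0 xstar, 0 < u x 0)
    (hupos : ∀ x ∈ Set.Icc 0 xstar, ∀ t ≥ (0:ℝ), 0 < u x t)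
    (hα0 : 0 < α 0)
    :
    ∃ ε > (0:ℝ), ∀ t ≥ (0:ℝ),
      ε ≤ w t ∧ ε ≤ v t ∧ ∀ x ∈ Set.Icc 0 xstar, ε ≤ u x t := by

  have hwc : ContinuousOn w (Set.Ici 0) := hwC1.continuousOn
  have hvc : ContinuousOn v (Set.Ici 0) := hvC1.continuousOn
  have hwpos : ∀ t ≥ (0:ℝ), 0 < w t := fun t ht => by
    rw [← hbc t ht]; exact hupos 0 ⟨le_rfl, hxstar.le⟩ t ht
  -- positivity of v
  have hvpos : ∀ t ≥ (0:ℝ), 0 < v t := by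
    intro t1 ht1
    by_contra hle
    push Not at hle
    have hcI : ContinuousOn v (Set.Icc 0 t1) := hvc.mono Set.Icc_subset_Ici_self
    have hcl : IsCompact (Set.Icc 0 t1 ∩ v ⁻¹' Set.Iic 0) :=
      isCompact_Icc.of_isClosed_subset
        (hcI.preimage_isClosed_of_isClosed isClosed_Icc isClosed_Iic) Set.inter_subset_left
    obtain ⟨s, ⟨⟨hs0, hs1⟩, hsm⟩, hsmin⟩ := hcl.exists_isLeast ⟨t1, ⟨ht1, le_rfl⟩, hle⟩
    have hsm : v s ≤ 0 := hsm
    have hmono : MonotoneOn (fun t => v t * Real.exp (mu * t)) (Set.Icc 0 s) := by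
      have hD : ∀ x > (0:ℝ), HasDerivAt (fun t => v t * Real.exp (mu * t))
          ((g xstar (v x) * u xstar x - mu * v x) * Real.exp (mu * x)
            + v x * (Real.exp (mu * x) * (mu * 1))) x := fun x hx =>
        (hveq x hx).mul (((hasDerivAt_id x).const_mul mu).exp)
      apply monotoneOn_of_deriv_nonneg (convex_Icc 0 s)
      · exact (hcI.mono (Set.Icc_subset_Icc_right hs1)).mul (by fun_prop)
      · intro x hx
        rw [interior_Icc] at hx
        exact (hD x hx.1).differentiableAt.differentiableWithinAt
      · intro x hx
        rw [interior_Icc] at hx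
        rw [(hD x hx.1).deriv]
        have hvx : 0 ≤ v x := by
          by_contra hn
          push Not at hn
          exact absurd (hsmin ⟨⟨hx.1.le, hx.2.le.trans hs1⟩, hn.le⟩) (not_le.mpr hx.2)
        have h1 := (hgbound xstar ⟨hxstar.le, le_rfl⟩ (v x) hvx).1
        have h2 := hupos xstar ⟨hxstar.le, le_rfl⟩ x hx.1.le
        have h3 : 0 ≤ (g xstar (v x) * u xstar x) * Real.exp (mu * x) :=
          mul_nonneg (mul_nonneg (by linarith) h2.le) (Real.exp_pos _).le
        linarith
    have h := hmono (Set.left_mem_Icc.mpr hs0) (Set.right_mem_Icc.mpr hs0) hs0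
    simp only [mul_zero, Real.exp_zero, mul_one] at h
    have := mul_nonpos_of_nonpos_of_nonneg hsm (Real.exp_pos (mu * s)).le
    linarith
  -- bound for p
  obtain ⟨P, hP⟩ := isCompact_Icc.exists_bound_of_continuousOn hpC1.continuousOn
  simp only [Real.norm_eq_abs] at hP
  obtain ⟨lam, hlam0, hlam⟩ : ∃ lam : ℝ, 0 < lam ∧ P + Kg + |αinf| + |α0| + 1 ≤ lam * gm := by
    refine ⟨(|P| + |Kg| + |αinf| + |α0| + 1) / gm, by positivity, ?_⟩
    rw [div_mul_cancel₀ _ hgm.ne']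
    linarith [le_abs_self P, le_abs_self Kg]
  have huc := huC1.continuousOn
  -- derivative computation
  have hder : ∀ k κ : ℝ, ∀ t > (0:ℝ), ∀ x ∈ Set.Ioo 0 xstar, ∃ a b G q : ℝ, 0 < G ∧
      HasDerivAt (fun s => k * (u x s * Real.exp (κ * x) / w s)) a t ∧
      HasDerivAt (fun y => k * (u y t * Real.exp (κ * y) / w t)) b x ∧
      gm ≤ G ∧ |q| ≤ P + Kg + |αinf| + |α0| ∧
      a + G * b = k * (q + κ * G) * (Real.exp (κ * x) / w t * u x t) := by
    intro k κ t ht x hx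
    have hxI : x ∈ Set.Icc 0 xstar := ⟨hx.1.le, hx.2.le⟩
    have hvt := hvpos t ht.le
    have hwt := hwpos t ht.le
    have hG := (hgbound x hxI (v t) hvt.le).1
    have hdu : DifferentiableAt ℝ (fun q : ℝ × ℝ => u q.1 q.2) (x, t) := by
      refine (huC1.differentiableOn one_ne_zero).differentiableAt ?_
      exact prod_mem_nhds (Icc_mem_nhds hx.1 hx.2) (Ici_mem_nhds ht)
    have hdt : DifferentiableAt ℝ (fun s => u x s) t :=
      DifferentiableAt.comp (f := fun s : ℝ => (x, s)) t hdu (by fun_prop)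
    have hdx : DifferentiableAt ℝ (fun y => u y t) x :=
      DifferentiableAt.comp (f := fun y : ℝ => (y, t)) x hdu (by fun_prop)
    have hdg : DifferentiableAt ℝ (fun y => g y (v t)) x :=
      ((hgC2 (v t) hvt.le).differentiableOn two_ne_zero).differentiableAt
        (Icc_mem_nhds hx.1 hx.2)
    have hpde := hueq t ht x hx
    have hprod : deriv (fun y => g y (v t) * u y t) x = _ :=
      (hdg.hasDerivAt.mul hdx.hasDerivAt).deriv
    rw [hprod] at hpde
    have hE : HasDerivAt (fun y => Real.exp (κ * y)) (Real.exp (κ * x) * (κ * 1)) x :=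
      ((hasDerivAt_id x).const_mul κ).exp
    refine ⟨_, _, g x (v t), p x - deriv (fun y => g y (v t)) x - α (v t), by linarith,
      (((hdt.hasDerivAt.mul_const (Real.exp (κ * x))).div (hweq t ht) hwt.ne').const_mul k),
      (((hdx.hasDerivAt.mul hE).div_const (w t)).const_mul k), hG, ?_, ?_⟩
    · have h1 := abs_le.mp (hP x hxI)
      have h2 := abs_le.mp (hgderivbdd x hxI (v t) hvt.le).1
      have h3 := hαrange (v t) hvt.le
      rw [abs_le]
      constructor <;> linarith [h1.1, h1.2, h2.1, h2.2, h3.1, h3.2, neg_abs_le αinf, le_abs_self α0,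
        abs_nonneg αinf, abs_nonneg α0]
    · have e1 : deriv (fun s => u x s) t = p x * u x t -
        (deriv (fun y => g y (v t)) x * u x t + g x (v t) * deriv (fun y => u y t) x) := by
        linarith
      rw [e1]
      field_simp
      ring
  have hfc : ∀ k κ : ℝ, ContinuousOn (fun q : ℝ × ℝ => k * (u q.1 q.2 * Real.exp (κ * q.1) / w q.2))
      (Set.Icc 0 xstar ×ˢ Set.Ici 0) := by
    intro k κ
    have h1 : ContinuousOn (fun q : ℝ × ℝ => w q.2) (Set.Icc 0 xstar ×ˢ Set.Ici 0) :=
      hwc.comp (by fun_prop) (fun q hq => hq.2)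
    exact continuousOn_const.mul ((huc.mul (by fun_prop)).div h1 (fun q hq => (hwpos q.2 hq.2).ne'))
  have hf0 : ∀ k κ : ℝ, ∃ z ∈ Set.Icc 0 xstar, ∀ x ∈ Set.Icc 0 xstar,
      k * (u x 0 * Real.exp (κ * x) / w 0) ≤ k * (u z 0 * Real.exp (κ * z) / w 0) := by
    intro k κ
    have h1 : ContinuousOn (fun x => k * (u x 0 * Real.exp (κ * x) / w 0)) (Set.Icc 0 xstar) :=
      (hfc k κ).comp (f := fun y : ℝ => (y, (0:ℝ))) (by fun_prop)
        (fun y hy => ⟨hy, le_refl (0:ℝ)⟩)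
    obtain ⟨z, hz, hm⟩ := isCompact_Icc.exists_isMaxOn ⟨0, le_rfl, hxstar.le⟩ h1
    exact ⟨z, hz, fun x hx => hm hx⟩
  have hside : ∀ k κ : ℝ, ∀ t ≥ (0:ℝ), k * (u 0 t * Real.exp (κ * 0) / w t) = k := by
    intro k κ t ht
    rw [hbc t ht, mul_zero, Real.exp_zero, mul_one, div_self (hwpos t ht).ne', mul_one]
  have hposE : ∀ κ : ℝ, ∀ t ≥ (0:ℝ), ∀ x ∈ Set.Icc 0 xstar, 0 < Real.exp (κ * x) / w t * u x t :=
    fun κ t ht x hx => mul_pos (div_pos (Real.exp_pos _) (hwpos t ht)) (hupos x hx t ht)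
  -- upper comparison
  obtain ⟨C, hC0, hC⟩ : ∃ C > 0, ∀ t ≥ (0:ℝ), ∀ x ∈ Set.Icc 0 xstar, u x t ≤ C * w t := by
    obtain ⟨z, hz, hzm⟩ := hf0 1 (-lam)
    set M := max (1 * (u z 0 * Real.exp (-lam * z) / w 0)) 1 with hM
    have hM1 : 1 ≤ M := le_max_right _ _
    have hmp := max_principle_aux (fun x t => 1 * (u x t * Real.exp (-lam * x) / w t)) xstar M hxstar
      (hfc 1 (-lam)) (fun x hx => (hzm x hx).trans (le_max_left _ _))
      (fun t ht => by simp only [hside 1 (-lam) t ht]; exact hM1)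
      (by
        intro t ht x hx
        obtain ⟨a, b, G, q, hG, ha, hb, hGm, hq, he⟩ := hder 1 (-lam) t ht x hx
        refine ⟨a, b, G, hG, ha, hb, ?_⟩
        rw [he]
        apply mul_neg_of_neg_of_pos _ (hposE _ t ht.le x ⟨hx.1.le, hx.2.le⟩)
        have := mul_le_mul_of_nonneg_left hGm hlam0.le
        linarith [le_abs_self q])
    refine ⟨M * Real.exp (lam * xstar), by positivity, fun t ht x hx => ?_⟩
    have h1 := hmp t ht x hx
    simp only [one_mul] at h1
    rw [div_le_iff₀ (hwpos t ht), neg_mul, Real.exp_neg, ← div_eq_mul_inv,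
      div_le_iff₀ (Real.exp_pos _)] at h1
    refine h1.trans ?_
    have h2 : Real.exp (lam * x) ≤ Real.exp (lam * xstar) :=
      Real.exp_le_exp.mpr (mul_le_mul_of_nonneg_left hx.2 hlam0.le)
    have h3 := mul_le_mul_of_nonneg_left h2 (mul_nonneg (by linarith : 0 ≤ M) (hwpos t ht).le)
    linarith
  -- lower comparison
  obtain ⟨c, hc0, hc⟩ : ∃ c > 0, ∀ t ≥ (0:ℝ), ∀ x ∈ Set.Icc 0 xstar, c * w t ≤ u x t := by
    obtain ⟨z, hz, hzm⟩ := hf0 (-1) lam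
    set M := max (-1 * (u z 0 * Real.exp (lam * z) / w 0)) (-1) with hM
    have hM1 : -1 ≤ M := le_max_right _ _
    have hMneg : M < 0 := by
      apply max_lt _ (by norm_num)
      have : 0 < u z 0 * Real.exp (lam * z) / w 0 :=
        div_pos (mul_pos (hu0pos z hz) (Real.exp_pos _)) hw0
      linarith
    have hmp := max_principle_aux (fun x t => -1 * (u x t * Real.exp (lam * x) / w t)) xstar M hxstar
      (hfc (-1) lam) (fun x hx => (hzm x hx).trans (le_max_left _ _))
      (fun t ht => by simp only [hside (-1) lam t ht]; exact hM1)
      (by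
        intro t ht x hx
        obtain ⟨a, b, G, q, hG, ha, hb, hGm, hq, he⟩ := hder (-1) lam t ht x hx
        refine ⟨a, b, G, hG, ha, hb, ?_⟩
        rw [he]
        apply mul_neg_of_neg_of_pos _ (hposE _ t ht.le x ⟨hx.1.le, hx.2.le⟩)
        have := mul_le_mul_of_nonneg_left hGm hlam0.le
        linarith [neg_abs_le q])
    refine ⟨-M / Real.exp (lam * xstar), div_pos (by linarith) (Real.exp_pos _), fun t ht x hx => ?_⟩
    have h1 : -M ≤ u x t * Real.exp (lam * x) / w t := by linarith [hmp t ht x hx]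
    rw [le_div_iff₀ (hwpos t ht)] at h1
    rw [div_mul_eq_mul_div, div_le_iff₀ (Real.exp_pos _)]
    refine h1.trans ?_
    have h2 : Real.exp (lam * x) ≤ Real.exp (lam * xstar) :=
      Real.exp_le_exp.mpr (mul_le_mul_of_nonneg_left hx.2 hlam0.le)
    exact mul_le_mul_of_nonneg_left h2 (hupos x hx t ht).le
  -- differential inequalities for v
  have hxs : xstar ∈ Set.Icc 0 xstar := ⟨hxstar.le, le_rfl⟩
  have hgp : 0 < gp := by
    have := hgbound xstar hxs 0 (le_refl (0:ℝ))
    linarith [this.1, this.2]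
  obtain ⟨a, ha⟩ : ∃ a, a = gm * c := ⟨_, rfl⟩
  obtain ⟨b, hb⟩ : ∃ b, b = gp * C := ⟨_, rfl⟩
  have ha0 : 0 < a := ha ▸ mul_pos hgm hc0
  have hb0 : 0 < b := hb ▸ mul_pos hgp hC0
  have hlo : ∀ t ≥ (0:ℝ), a * w t ≤ g xstar (v t) * u xstar t := by
    intro t ht
    have h1 := hgbound xstar hxs (v t) (hvpos t ht).le
    have h2 := mul_le_mul h1.1 (hc t ht xstar hxs) (mul_pos hc0 (hwpos t ht)).le
      (hgm.le.trans h1.1)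
    rw [ha]; linarith
  have hhi : ∀ t ≥ (0:ℝ), g xstar (v t) * u xstar t ≤ b * w t := by
    intro t ht
    have h1 := hgbound xstar hxs (v t) (hvpos t ht).le
    have h2 := mul_le_mul h1.2 (hC t ht xstar hxs) (hupos xstar hxs t ht).le hgp.le
    rw [hb]; linarith
  have hα0' : 0 < α0 := by linarith [(hαrange 0 (le_refl (0:ℝ))).2]
  -- v / w bounded below
  obtain ⟨r, hr0, hr⟩ : ∃ r > 0, ∀ t ≥ (0:ℝ), r * w t ≤ v t := by
    have hpos : 0 < mu + α0 := by linarith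
    refine ⟨min (v 0 / w 0) (a / (mu + α0)), lt_min (div_pos hv0 hw0) (div_pos ha0 hpos), ?_⟩
    have := barrier_aux (fun t => v t / w t) _ (min (v 0 / w 0) (a / (mu + α0)))
      (hvc.div hwc (fun t ht => (hwpos t ht).ne'))
      (fun t ht => (hveq t ht).div (hweq t ht) (hwpos t ht.le).ne') (min_le_left _ _)
      (by
        intro t ht hlt
        have hwt := hwpos t ht.le
        have hvt := hvpos t ht.le
        have h1 := lt_of_lt_of_le hlt (min_le_right _ _)
        rw [div_lt_div_iff₀ hwt hpos] at h1
        have h2 := hlo t ht.le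
        have h3 := mul_le_mul_of_nonneg_right (hαrange (v t) hvt.le).2 hvt.le
        apply div_nonneg _ (sq_nonneg _)
        have h4 : 0 ≤ w t * (g xstar (v t) * u xstar t - mu * v t - α (v t) * v t) :=
          mul_nonneg hwt.le (by linarith)
        linarith)
    intro t ht
    exact (le_div_iff₀ (hwpos t ht)).mp (this t ht)
  -- w bounded
  obtain ⟨W, hW0, hW⟩ : ∃ W > 0, ∀ t ≥ (0:ℝ), w t ≤ W := by
    obtain ⟨s, hs⟩ := ((hαlim.eventually (gt_mem_nhds hαinf)).and
      (Filter.eventually_ge_atTop 0)).exists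
    refine ⟨max (w 0) (s / r), lt_max_of_lt_left hw0, ?_⟩
    have := barrier_aux (fun t => - w t) _ (-max (w 0) (s / r)) hwc.neg
      (fun t ht => (hweq t ht).neg) (neg_le_neg (le_max_left _ _))
      (by
        intro t ht hlt
        have h1 : s / r < w t := lt_of_le_of_lt (le_max_right (w 0) _) (neg_lt_neg_iff.mp hlt)
        rw [div_lt_iff₀ hr0] at h1
        have h2 := hr t ht.le
        have h3 := hαanti hs.2 (hvpos t ht.le).le (by linarith : s < v t)
        have := mul_nonneg (by linarith [hs.1] : 0 ≤ - α (v t)) (hwpos t ht.le).le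
        linarith)
    intro t ht
    exact neg_le_neg_iff.mp (this t ht)
  -- v bounded
  obtain ⟨V, hV⟩ : ∃ V, ∀ t ≥ (0:ℝ), v t ≤ V := by
    refine ⟨max (v 0) (b * W / mu), ?_⟩
    have := barrier_aux (fun t => - v t) _ (-max (v 0) (b * W / mu)) hvc.neg
      (fun t ht => (hveq t ht).neg) (neg_le_neg (le_max_left _ _))
      (by
        intro t ht hlt
        have h1 : b * W / mu < v t := lt_of_le_of_lt (le_max_right (v 0) _) (neg_lt_neg_iff.mp hlt)
        rw [div_lt_iff₀ hmu] at h1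
        have h2 := hhi t ht.le
        have h3 := mul_le_mul_of_nonneg_left (hW t ht.le) hb0.le
        linarith)
    intro t ht
    exact neg_le_neg_iff.mp (this t ht)
  -- choose delta
  obtain ⟨δ, hδ0, hδ⟩ : ∃ δ > 0, 0 < α δ := by
    have h1 : ∀ᶠ s in nhdsWithin 0 (Set.Ioi (0:ℝ)), 0 < α s :=
      ((hαcont 0 (le_refl (0:ℝ))).mono Set.Ioi_subset_Ici_self).eventually (lt_mem_nhds hα0)
    obtain ⟨δ, h⟩ := (h1.and self_mem_nhdsWithin).exists
    exact ⟨δ, h.2, h.1⟩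
  obtain ⟨K, hKd⟩ : ∃ K, K = (α δ - αinf) / δ := ⟨_, rfl⟩
  have hK0 : 0 < K := hKd ▸ div_pos (by linarith) hδ0
  have hKδ : K * δ = α δ - αinf := by rw [hKd]; exact div_mul_cancel₀ _ hδ0.ne'
  have hαK : ∀ s ≥ (0:ℝ), α δ ≤ α s + K * s := by
    intro s hs
    rcases le_total s δ with h | h
    · have := hαanti.antitoneOn hs hδ0.le h
      have := mul_nonneg hK0.le hs
      linarith
    · have := mul_le_mul_of_nonneg_left h hK0.le
      linarith [(hαrange s hs).1]
  obtain ⟨ω, hω0, hω⟩ : ∃ ω > 0, ∀ t ≥ (0:ℝ), ω ≤ w t := by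
    obtain ⟨wb, hwb⟩ : ∃ wb, wb = α δ / (K / mu * b) := ⟨_, rfl⟩
    have hkm : 0 < K / mu := div_pos hK0 hmu
    have hwb0 : 0 < wb := hwb ▸ div_pos hδ (mul_pos hkm hb0)
    have hwb' : K / mu * b * wb = α δ := by
      rw [hwb]; exact mul_div_cancel₀ _ (mul_pos hkm hb0).ne'
    obtain ⟨m, hm⟩ : ∃ m, m = min (Real.log (w 0) - K / mu * v 0) (Real.log wb - K / mu * V) :=
      ⟨_, rfl⟩
    have := barrier_aux (fun t => Real.log (w t) - K / mu * v t) _ m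
      ((hwc.log (fun t ht => (hwpos t ht).ne')).sub (continuousOn_const.mul hvc))
      (fun t ht => ((hweq t ht).log (hwpos t ht.le).ne').sub ((hveq t ht).const_mul (K / mu)))
      (hm ▸ min_le_left _ _)
      (by
        intro t ht hlt
        have hwt := hwpos t ht.le
        have h1 : Real.log (w t) - K / mu * v t < Real.log wb - K / mu * V :=
          lt_of_lt_of_le hlt (hm ▸ min_le_right _ _)
        have h2 := mul_le_mul_of_nonneg_left (hV t ht.le) hkm.le
        have h3 : w t < wb := (Real.log_lt_log_iff hwt hwb0).mp (by linarith)
        rw [mul_div_cancel_right₀ _ hwt.ne']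
        have h4 := hαK (v t) (hvpos t ht.le).le
        have h5 := mul_le_mul_of_nonneg_left (hhi t ht.le) hkm.le
        have h6 := mul_le_mul_of_nonneg_left h3.le (mul_pos hkm hb0).le
        have h7 : K / mu * (mu * v t) = K * v t := by field_simp
        rw [mul_sub, h7]
        linarith)
    refine ⟨Real.exp m, Real.exp_pos _, fun t ht => ?_⟩
    rw [← Real.le_log_iff_exp_le (hwpos t ht)]
    have h1 := this t ht
    have h2 := mul_pos hkm (hvpos t ht)
    linarith
  obtain ⟨ν, hν0, hν⟩ : ∃ ν > 0, ∀ t ≥ (0:ℝ), ν ≤ v t := by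
    refine ⟨min (v 0) (a * ω / mu), lt_min hv0 (by positivity), ?_⟩
    refine barrier_aux v _ _ hvc hveq (min_le_left _ _) ?_
    intro t ht hlt
    have h1 := lt_of_lt_of_le hlt (min_le_right _ _)
    rw [lt_div_iff₀ hmu] at h1
    have h2 := mul_le_mul_of_nonneg_left (hω t ht.le) ha0.le
    linarith [hlo t ht.le]
  refine ⟨min ω (min ν (c * ω)), by positivity, fun t ht => ⟨?_, ?_, fun x hx => ?_⟩⟩
  · exact (min_le_left _ _).trans (hω t ht)
  · exact ((min_le_right _ _).trans (min_le_left _ _)).trans (hν t ht)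
  · refine ((min_le_right _ _).trans (min_le_right _ _)).trans ?_
    exact (mul_le_mul_of_nonneg_left (hω t ht) hc0.le).trans (hc t ht x hx)
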